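/- If G is a K_{2,3}-saturated n-by-n bipartite graph with fewer than 3n-2 edges (n ≥ 4), then G has no vertex of degree 1. -/

import Mathlib

open Finset

/-- The bipartite graph (with parts indexed by `Fin n`) whose edge set is `E`
contains a complete bipartite graph with `a` vertices on the left and `b` on the right. -/
def containsK {n : ℕ} (E : Finset (Fin n × Fin n)) (a b : ℕ) : Prop :=
  ∃ S T : Finset (Fin n), S.card = a ∧ T.card = b ∧ ∀ u ∈ S, ∀ v ∈ T, (u, v) ∈ E

/-- `E` is (unordered) `K_{s,t}`-saturated: no copy of `K_{s,t}` in either orientation,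
and adding any missing edge creates one. -/
def Saturated {n : ℕ} (s t : ℕ) (E : Finset (Fin n × Fin n)) : Prop :=
  ¬ (containsK E s t ∨ containsK E t s) ∧
    ∀ u v : Fin n, (u, v) ∉ E →
      (containsK (insert (u, v) E) s t ∨ containsK (insert (u, v) E) t s)

/-- Degree of a left vertex. -/
def degL {n : ℕ} (E : Finset (Fin n × Fin n)) (u : Fin n) : ℕ :=
  (E.filter fun p => p.1 = u).card

/-- Degree of a right vertex. -/
def degR {n : ℕ} (E : Finset (Fin n × Fin n)) (v : Fin n) : ℕ :=
  (E.filter fun p => p.2 = v).card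

lemma sat_new {n : ℕ} {E : Finset (Fin n × Fin n)} (h : Saturated 2 3 E) {u v : Fin n}
    (huv : (u, v) ∉ E) : ∃ S T : Finset (Fin n), u ∈ S ∧ v ∈ T ∧
      ((S.card = 2 ∧ T.card = 3) ∨ (S.card = 3 ∧ T.card = 2)) ∧
      ∀ a ∈ S, ∀ b ∈ T, (a, b) = (u, v) ∨ (a, b) ∈ E := by
  obtain ⟨h1, h2⟩ := h
  have key : ∀ S T : Finset (Fin n), ((S.card = 2 ∧ T.card = 3) ∨ (S.card = 3 ∧ T.card = 2)) →
      (∀ a ∈ S, ∀ b ∈ T, (a, b) ∈ insert (u, v) E) →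
      u ∈ S ∧ v ∈ T := by
    intro S T hc hE
    by_contra hcon
    have hall : ∀ a ∈ S, ∀ b ∈ T, (a, b) ∈ E := by
      intro a ha b hb
      rcases Finset.mem_insert.1 (hE a ha b hb) with h | h
      · simp only [Prod.mk.injEq] at h
        exact absurd ⟨h.1 ▸ ha, h.2 ▸ hb⟩ hcon
      · exact h
    apply h1
    rcases hc with hc | hc
    · exact Or.inl ⟨S, T, hc.1, hc.2, hall⟩
    · exact Or.inr ⟨S, T, hc.1, hc.2, hall⟩
  rcases h2 u v huv with ⟨S, T, hS, hT, hE⟩ | ⟨S, T, hS, hT, hE⟩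
  · have := key S T (Or.inl ⟨hS, hT⟩) hE
    exact ⟨S, T, this.1, this.2, Or.inl ⟨hS, hT⟩, fun a ha b hb => Finset.mem_insert.1 (hE a ha b hb)⟩
  · have := key S T (Or.inr ⟨hS, hT⟩) hE
    exact ⟨S, T, this.1, this.2, Or.inr ⟨hS, hT⟩, fun a ha b hb => Finset.mem_insert.1 (hE a ha b hb)⟩

lemma left_case (n : ℕ) (E : Finset (Fin n × Fin n)) (hsat : Saturated 2 3 E)
    (hfew : E.card < 3 * n - 2) (u : Fin n) : degL E u ≠ 1 := by
  intro hd
  obtain ⟨⟨u', w⟩, hw⟩ := Finset.card_eq_one.1 hd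
  have hmem : ∀ p : Fin n × Fin n, (p ∈ E ∧ p.1 = u) ↔ p = (u', w) := by
    intro p
    rw [← Finset.mem_singleton (a := (u', w)), ← hw, Finset.mem_filter]
  obtain rfl : u' = u := ((hmem (u', w)).2 rfl).2
  have huw : ∀ v, (u', v) ∈ E ↔ v = w := by
    intro v
    have := hmem (u', v)
    simpa using this
  set N : Finset (Fin n) := univ.filter fun a => (a, w) ∈ E with hN
  have h1 : N.card ≤ (E.filter fun p => p.2 = w).card := by
    apply Finset.card_le_card_of_injOn (fun a => (a, w))
    · intro a ha
      have ha' : (a, w) ∈ E := by simpa [hN] using ha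
      simp [ha']
    · intro a _ b _ hab
      simpa using hab
  have h2 : 2 * (n - 1) ≤ (E.filter fun p => p.2 ≠ w ∧ p.1 ∈ N).card := by
    have hmaps : ∀ p ∈ (E.filter fun p => p.2 ≠ w ∧ p.1 ∈ N), p.2 ∈ univ.erase w := by
      intro p hp
      simp only [mem_filter] at hp
      simp [hp.2.1]
    rw [Finset.card_eq_sum_card_fiberwise hmaps]
    have hcard : (univ.erase w : Finset (Fin n)).card = n - 1 := by simp
    calc 2 * (n - 1) = ∑ _v ∈ univ.erase w, 2 := by simp [mul_comm]
      _ ≤ _ := by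
        apply Finset.sum_le_sum
        intro v hv
        have hvw : v ≠ w := by simpa using hv
        obtain ⟨S, T, hS, hT, hc, hE⟩ := sat_new hsat (u := u') (v := v) (by rwa [huw])
        have hTs : T ⊆ {v, w} := by
          intro b hb
          rcases hE u' hS b hb with h | h
          · simp only [Prod.mk.injEq] at h
            simp [h.2]
          · simp [(huw b).1 h]
        have hT2 : T.card ≤ 2 := (Finset.card_le_card hTs).trans Finset.card_le_two
        have hTe : T = {v, w} := Finset.eq_of_subset_of_card_le hTs
          (Finset.card_le_two.trans (by omega))
        have hSe : (S.erase u').card = 2 := by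
          rw [Finset.card_erase_of_mem hS]; omega
        rw [← hSe]
        apply Finset.card_le_card_of_injOn (fun a => (a, v))
        · intro a ha
          have ha' : a ≠ u' ∧ a ∈ S := Finset.mem_erase.1 (Finset.mem_coe.1 ha)
          have e1 : (a, v) ∈ E := by
            rcases hE a ha'.2 v hT with h | h
            · simp only [Prod.mk.injEq] at h
              exact absurd h.1 ha'.1
            · exact h
          have e2 : (a, w) ∈ E := by
            rcases hE a ha'.2 w (by simp [hTe]) with h | h
            · simp only [Prod.mk.injEq] at h
              exact absurd h.1 ha'.1
            · exact h
          simp [hN, e1, e2, hvw]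
        · intro a _ b _ hab
          simpa using hab
  have h3 : Nᶜ.card ≤ (E.filter fun p => p.1 ∉ N).card := by
    apply Finset.card_le_card_of_surjOn Prod.fst
    intro b hb
    have hb' : (b, w) ∉ E := by simpa [hN] using hb
    obtain ⟨S, T, hS, hT, hc, hE⟩ := sat_new hsat hb'
    obtain ⟨t, ht, htw⟩ := Finset.exists_mem_ne (s := T) (by omega) w
    rcases hE b hS t ht with h | h
    · simp only [Prod.mk.injEq] at h
      exact absurd h.2 htw
    · exact ⟨(b, t), by simp [hN, h, hb'], rfl⟩
  rw [Finset.card_compl, Fintype.card_fin] at h3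
  have hNn : N.card ≤ n := by simpa using Finset.card_le_univ N
  have hpos : 0 < n := u'.pos
  have hs1 := Finset.card_filter_add_card_filter_not (s := E) (fun p => p.1 ∈ N)
  have hs2 := Finset.card_filter_add_card_filter_not (s := E.filter fun p => p.1 ∈ N)
    (fun p => p.2 = w)
  rw [Finset.filter_filter, Finset.filter_filter] at hs2
  have e1 : (E.filter fun p => p.1 ∈ N ∧ p.2 = w) = E.filter fun p => p.2 = w := by
    apply Finset.filter_congr
    rintro ⟨a, b⟩ hab
    simp only [hN, mem_filter, mem_univ, true_and]
    constructor
    · exact fun h => h.2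
    · rintro rfl
      exact ⟨hab, rfl⟩
  have e2 : (E.filter fun p => p.1 ∈ N ∧ ¬ p.2 = w) = E.filter fun p => p.2 ≠ w ∧ p.1 ∈ N := by
    apply Finset.filter_congr
    intro p _
    exact and_comm
  rw [e1, e2] at hs2
  omega

lemma contains_swap {n : ℕ} {E F : Finset (Fin n × Fin n)}
    (hF : ∀ a b, (a, b) ∈ E → (b, a) ∈ F) {s t : ℕ} (h : containsK E s t) : containsK F t s := by
  obtain ⟨S, T, hS, hT, hE⟩ := h
  exact ⟨T, S, hT, hS, fun b hb a ha => hF _ _ (hE a ha b hb)⟩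

theorem stmt14 (n : ℕ) (hn : 4 ≤ n)
    (E : Finset (Fin n × Fin n)) (hsat : Saturated 2 3 E)
    (hfew : E.card < 3 * n - 2) :
    (∀ u : Fin n, degL E u ≠ 1) ∧ (∀ v : Fin n, degR E v ≠ 1) := by
  refine ⟨left_case n E hsat hfew, fun v => ?_⟩
  set F : Finset (Fin n × Fin n) := E.map (Equiv.prodComm _ _).toEmbedding with hF
  have hm : ∀ a b, (a, b) ∈ F ↔ (b, a) ∈ E := by
    intro a b
    simp [hF]
  have hdeg : degR E v = degL F v := by
    unfold degR degL
    rw [hF, Finset.filter_map, Finset.card_map]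
    rfl
  rw [hdeg]
  apply left_case n F _ (by rw [hF, Finset.card_map]; exact hfew)
  refine ⟨?_, ?_⟩
  · rintro (h | h)
    · exact hsat.1 (Or.inr (contains_swap (fun a b => (hm a b).1) h))
    · exact hsat.1 (Or.inl (contains_swap (fun a b => (hm a b).1) h))
  · intro a b hab
    have hins : ∀ x y, (x, y) ∈ insert (b, a) E → (y, x) ∈ insert (a, b) F := by
      intro x y h
      simp only [mem_insert, Prod.mk.injEq, hm] at h ⊢
      tauto
    rcases hsat.2 b a (by rwa [← hm]) with h | h
    · exact Or.inr (contains_swap hins h)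
    · exact Or.inl (contains_swap hins h)
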